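/- Let v ∈ C_b(Ω,ℝ^d). Then for all p,q > 1 and all ω ∈ Ω* ∩ Ω_{p,q}, limsup_{r→∞} |Λ_r|^{-1} E_{Λ_r}^ω(v) ≤ inf_{h∈C_b(Ω)} ⟨v − ∇h, c(v − ∇h)⟩_{L²(P_ω,ℝ^d)}. -/

import Mathlib

open MeasureTheory Filter Topology Matrix
open scoped ENNReal NNReal

noncomputable section

namespace DetCond

/-- Vertices of `ℤ^d`. -/
abbrev Vert (d : ℕ) := Fin d → ℤ

/-- Index of the (unordered) nearest-neighbour edge `(x, x + e i)` of `ℤ^d`;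
the set of these indices is in natural bijection with `E(ℤ^d)` modulo orientation. -/
abbrev EdgeIx (d : ℕ) := Vert d × Fin d

/-- The space `Ω = (0,∞)^{E(ℤ^d)}` of (symmetric) conductance configurations, with
its product topology and product σ-algebra. -/
abbrev EnvSp (d : ℕ) := {ω : EdgeIx d → ℝ // ∀ e, 0 < ω e}

/-- The `i`-th coordinate unit vector of `ℤ^d`. -/
def unitv (d : ℕ) (i : Fin d) : Vert d := fun j => if j = i then 1 else 0

/-- The translation `τ_x` acting on environments: `c_{τ_x ω}(y,z) = c_ω(y+x,z+x)`. -/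
def shift (d : ℕ) (x : Vert d) (ω : EnvSp d) : EnvSp d :=
  ⟨fun e => ω.1 (e.1 + x, e.2), fun e => ω.2 (e.1 + x, e.2)⟩

/-- The conductance `c_ω(x,y)`; it vanishes when `x,y` are not nearest neighbours
and is symmetric in `x,y` by construction. -/
def cnd (d : ℕ) (ω : EnvSp d) (x y : Vert d) : ℝ :=
  ∑ i, ((if y = x + unitv d i then ω.1 (x, i) else 0) +
        (if x = y + unitv d i then ω.1 (y, i) else 0))

/-- `π_ω(x) = Σ_{z : (x,z) ∈ E(ℤ^d)} c_ω(x,z)`. -/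
def piOf (d : ℕ) (ω : EnvSp d) (x : Vert d) : ℝ :=
  ∑ i, (ω.1 (x, i) + ω.1 (x - unitv d i, i))

/-- The box `Λ_r = [-r,r]^d ∩ ℤ^d`. -/
def box (d : ℕ) (r : ℝ) : Finset (Vert d) :=
  Fintype.piFinset fun _ : Fin d => Finset.Icc ⌈-r⌉ ⌊r⌋

/-- The nearest neighbours of `x` in `ℤ^d`. -/
def nbrs (d : ℕ) (x : Vert d) : Finset (Vert d) :=
  (Finset.univ.image fun i => x + unitv d i) ∪ (Finset.univ.image fun i => x - unitv d i)

/-- The set `E(Λ)` of edges incident with at least one vertex of `Λ`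
(one index per unordered edge). -/
def edgesIn (d : ℕ) (Λ : Finset (Vert d)) : Finset (EdgeIx d) :=
  Λ.biUnion fun x =>
    (Finset.univ.image fun i => (x, i)) ∪ (Finset.univ.image fun i => (x - unitv d i, i))

/-- Bounded functions on `Ω`. -/
def IsBdd (d : ℕ) (f : EnvSp d → ℝ) : Prop := ∃ M, ∀ ω, |f ω| ≤ M

/-- Local functions: `f` depends only on the coordinates in some finite set `B` of edges
and, viewed as a function of those coordinates, has compact support in `(0,∞)^B`. -/
def IsLocalFn (d : ℕ) (f : EnvSp d → ℝ) : Prop :=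
  ∃ B : Finset (EdgeIx d),
    (∀ ω₁ ω₂ : EnvSp d, (∀ e ∈ B, ω₁.1 e = ω₂.1 e) → f ω₁ = f ω₂) ∧
    ∃ a b : ℝ, 0 < a ∧ ∀ ω : EnvSp d, (∃ e ∈ B, ω.1 e < a ∨ b < ω.1 e) → f ω = 0

/-- `ℓ_ω(f) = L`, i.e. the block averages of the translates of `f` converge to `L`. -/
def avgTo (d : ℕ) (ω : EnvSp d) (f : EnvSp d → ℝ) (L : ℝ) : Prop :=
  Tendsto (fun n : ℕ => (∑ x ∈ box d (n : ℝ), f (shift d x ω)) / ((box d (n : ℝ)).card : ℝ))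
    atTop (𝓝 L)

/-- `ω` is averaging: `ℓ_ω(f)` exists for every continuous local `f`. -/
def Averaging (d : ℕ) (ω : EnvSp d) : Prop :=
  ∀ f : EnvSp d → ℝ, Continuous f → IsLocalFn d f → ∃ L, avgTo d ω f L

/-- `ω` is tempered, i.e. `ω ∈ Ω'`. -/
def Tempered (d : ℕ) (ω : EnvSp d) : Prop :=
  Tendsto (fun ε : ℝ =>
      limsup (fun n : ℕ =>
        (∑ e ∈ edgesIn d (box d (n : ℝ)),
            (if ε ≤ ω.1 e ∧ ω.1 e ≤ ε⁻¹ then (0:ℝ) else 1)) / (n : ℝ) ^ d) atTop)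
    (𝓝[>] 0) (𝓝 0)

/-- `P` is the measure `ℙ_ω` associated with an averaging tempered `ω`:
the unique probability measure whose expectation of every bounded continuous function
is the corresponding block-average limit `ℓ_ω(f)`. -/
def IsEnvLaw (d : ℕ) (ω : EnvSp d) (P : Measure (EnvSp d)) : Prop :=
  IsProbabilityMeasure P ∧
    ∀ f : EnvSp d → ℝ, Continuous f → IsBdd d f → avgTo d ω f (∫ ω', f ω' ∂P)

/-- Ergodicity of a measure on `Ω` with respect to the translations of `ℤ^d`. -/
def ErgodicEnv (d : ℕ) (P : Measure (EnvSp d)) : Prop :=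
  ∀ A : Set (EnvSp d), MeasurableSet A → (∀ x : Vert d, shift d x ⁻¹' A = A) →
    P A = 0 ∨ P A = 1

/-- `ω ∈ Ω⋆`: tempered, averaging, and the associated measure `ℙ_ω` is ergodic. -/
def InOmegaStar (d : ℕ) (ω : EnvSp d) : Prop :=
  Tempered d ω ∧ Averaging d ω ∧
    ∀ P : Measure (EnvSp d), IsEnvLaw d ω P → ErgodicEnv d P

/-- `ω ∈ Ω_{p,q}`. -/
def InOmegaPQ (d : ℕ) (p q : ℝ) (ω : EnvSp d) : Prop :=
  (∃ C : ℝ, ∀ n : ℕ, 1 ≤ n →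
      (∑ e ∈ edgesIn d (box d (n : ℝ)), ω.1 e ^ p) / (n : ℝ) ^ d ≤ C) ∧
  (∃ C : ℝ, ∀ n : ℕ, 1 ≤ n →
      (∑ e ∈ edgesIn d (box d (n : ℝ)), ω.1 e ^ (-q)) / (n : ℝ) ^ d ≤ C)

/-- The path space of the discrete-time walk. -/
abbrev Path (d : ℕ) := ℕ → Vert d

/-- One-step transition probabilities `𝖯_ω(x,y) = c_ω(x,y)/π_ω(x)`. -/
def transP (d : ℕ) (ω : EnvSp d) (x y : Vert d) : ℝ := cnd d ω x y / piOf d ω x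

/-- `μ` is the law `P_ω^{x₀}` of the random walk among the conductances `ω`
started at `x₀`: a probability measure on the path space with the prescribed
finite-dimensional (cylinder) probabilities. -/
def IsWalkLaw (d : ℕ) (ω : EnvSp d) (x₀ : Vert d) (μ : Measure (Path d)) : Prop :=
  IsProbabilityMeasure μ ∧
    ∀ (n : ℕ) (γ : ℕ → Vert d),
      μ {w | ∀ k ≤ n, w k = γ k} =
        (if γ 0 = x₀ then 1 else 0) *
          ∏ k ∈ Finset.range n, ENNReal.ofReal (transP d ω (γ k) (γ (k+1)))

/-- `n`-step transition probabilities of the discrete-time walk. -/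
def stepP (d : ℕ) (ω : EnvSp d) : ℕ → Vert d → Vert d → ℝ
  | 0, x, y => if x = y then 1 else 0
  | n+1, x, y => ∑ z ∈ nbrs d x, transP d ω x z * stepP d ω n z y

/-- `P_ω^x(Y_t = y)` for the constant-speed continuous-time walk `Y_t = X_{N(t)}`,
where `N` is an independent rate-1 Poisson process. -/
def ctP (d : ℕ) (ω : EnvSp d) (t : ℝ) (x y : Vert d) : ℝ :=
  ∑' k : ℕ, Real.exp (-t) * t ^ k / (Nat.factorial k : ℝ) * stepP d ω k x y

/-- The `ℓ¹`-norm of a vertex of `ℤ^d`. -/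
def l1 (d : ℕ) (x : Vert d) : ℝ := ∑ i, |(x i : ℝ)|

/-- A vertex of `ℤ^d` regarded as a point of `ℝ^d`. -/
def ivert (d : ℕ) (x : Vert d) : Fin d → ℝ := fun i => (x i : ℝ)

/-- The linearly interpolated diffusively rescaled walk `B^{(n)}`. -/
def BnProc (d : ℕ) (n : ℕ) (w : Path d) (t : ℝ) : Fin d → ℝ :=
  (Real.sqrt n)⁻¹ •
    (ivert d (w ⌊t * n⌋₊) +
      (t * n - (⌊t * n⌋₊ : ℝ)) • (ivert d (w (⌊t * n⌋₊ + 1)) - ivert d (w ⌊t * n⌋₊)))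


/-- The measure `ℚ_ω` obtained from `ℙ_ω` by tilting with `π(0)`. -/
def Qmeas (d : ℕ) (P : Measure (EnvSp d)) : Measure (EnvSp d) :=
  P.withDensity fun ω' => ENNReal.ofReal (piOf d ω' 0 / ∫ ω'', piOf d ω'' 0 ∂P)

/-- The inner product `⟨f,g⟩_{L²(πμ)}`. -/
def innerP (d : ℕ) (P : Measure (EnvSp d)) (f g : EnvSp d → ℝ) : ℝ :=
  ∫ ω', f ω' * g ω' * piOf d ω' 0 ∂P

/-- The Dirichlet pairing `⟨h, (−L)h⟩_{L²(πμ)}`. -/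
def quadL (d : ℕ) (P : Measure (EnvSp d)) (h : EnvSp d → ℝ) : ℝ :=
  ∫ ω', (∑ z ∈ nbrs d 0, cnd d ω' 0 z * (h ω' - h (shift d z ω'))) * h ω' ∂P

/-- The inner product of `L²(ν)`. -/
def innerQ (d : ℕ) (ν : Measure (EnvSp d)) (f g : EnvSp d → ℝ) : ℝ :=
  ∫ ω', f ω' * g ω' ∂ν

/-- The Dirichlet pairing `⟨h, (−L)h⟩_{L²(ν)}`. -/
def quadQ (d : ℕ) (ν : Measure (EnvSp d)) (h : EnvSp d → ℝ) : ℝ :=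
  ∫ ω', ((piOf d ω' 0)⁻¹ *
      ∑ z ∈ nbrs d 0, cnd d ω' 0 z * (h ω' - h (shift d z ω'))) * h ω' ∂ν

/-- The set whose supremum is the variational characterization
`⟨f,(−L)⁻¹f⟩_{L²(ν)} = sup_h [2⟨h,f⟩ − ⟨h,(−L)h⟩]` (over bounded continuous `h`);
`⟨f,(−L)⁻¹f⟩_{L²(ν)} < ∞` means this set is bounded above. -/
def invPairSet (d : ℕ) (ν : Measure (EnvSp d)) (f : EnvSp d → ℝ) : Set ℝ :=
  {r | ∃ h : EnvSp d → ℝ, Continuous h ∧ IsBdd d h ∧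
        r = 2 * innerQ d ν h f - quadQ d ν h}

/-- The function `f(ω) = π_ω(0)⁻¹ ∇⋆(c v)(ω)` built from a vector field `v`. -/
def fDiv (d : ℕ) (v : EnvSp d → Fin d → ℝ) (ω : EnvSp d) : ℝ :=
  (piOf d ω 0)⁻¹ *
    ∑ i, (cnd d ω 0 (unitv d i) * v ω i -
          cnd d ω (-(unitv d i)) 0 * v (shift d (-(unitv d i)) ω) i)

/-- The inner product of `ℓ²(Λ,π_ω)`. -/
def innerF (d : ℕ) (ω : EnvSp d) (Λ : Finset (Vert d)) (f g : Vert d → ℝ) : ℝ :=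
  ∑ x ∈ Λ, f x * g x * piOf d ω x

/-- The pairing `⟨h, (−𝖫_ω)h⟩_{ℓ²(Λ,π_ω)}` for `h` vanishing outside `Λ`. -/
def quadF (d : ℕ) (ω : EnvSp d) (Λ : Finset (Vert d)) (h : Vert d → ℝ) : ℝ :=
  ∑ x ∈ Λ, (∑ z ∈ nbrs d x, cnd d ω x z * (h x - h z)) * h x

/-- `⟨f, (−𝖫_ω)⁻¹_Λ f⟩_{ℓ²(Λ,π_ω)}` via its variational characterization
`sup_h [2⟨h,f⟩ − ⟨h,(−𝖫_ω)h⟩]` over `h ∈ ℓ²(Λ,π_ω)`. -/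
def invPairF (d : ℕ) (ω : EnvSp d) (Λ : Finset (Vert d)) (f : Vert d → ℝ) : ℝ :=
  sSup {r | ∃ h : Vert d → ℝ, (∀ x ∉ Λ, h x = 0) ∧
      r = 2 * innerF d ω Λ h f - quadF d ω Λ h}

/-- The antisymmetric edge function `v∘τ(ω)`: the value assigned to the
edge `(x, x+e_i)` is `v_i(τ_x(ω))`. -/
def efield (d : ℕ) (v : EnvSp d → Fin d → ℝ) (ω : EnvSp d) : Vert d → Fin d → ℝ :=
  fun x i => v (shift d x ω) i

/-- The discrete gradient `∇h` of `h : ℤ^d → ℝ` as an edge function. -/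
def dgradE (d : ℕ) (h : Vert d → ℝ) : Vert d → Fin d → ℝ :=
  fun x i => h (x + unitv d i) - h x

/-- The inner product `⟨u,w⟩_{ℓ²(E(Λ), c_ω)}` of (antisymmetric) edge functions;
each unordered edge is counted once, which agrees with the paper's sum over
ordered edges carrying the factor ½. -/
def einner (d : ℕ) (ω : EnvSp d) (Λ : Finset (Vert d)) (u w : Vert d → Fin d → ℝ) : ℝ :=
  ∑ e ∈ edgesIn d Λ, u e.1 e.2 * w e.1 e.2 * ω.1 e

/-- The Dirichlet energy `𝓔_Λ^ω(v)`. -/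
def direnergy (d : ℕ) (ω : EnvSp d) (Λ : Finset (Vert d)) (v : EnvSp d → Fin d → ℝ) : ℝ :=
  sInf {r | ∃ h : Vert d → ℝ, (∀ x ∉ Λ, h x = 0) ∧
      r = einner d ω Λ (fun x i => efield d v ω x i - dgradE d h x i)
            (fun x i => efield d v ω x i - dgradE d h x i)}

/-- The gradient `∇h` of a function on `Ω`. -/
def gradOmega (d : ℕ) (h : EnvSp d → ℝ) : EnvSp d → Fin d → ℝ :=
  fun ω i => h (shift d (unitv d i) ω) - h ω

/-- The inner product `⟨u, c w⟩_{L²(P,ℝ^d)}`. -/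
def cinnerP (d : ℕ) (P : Measure (EnvSp d)) (u w : EnvSp d → Fin d → ℝ) : ℝ :=
  ∑ i, ∫ ω', cnd d ω' 0 (unitv d i) * u ω' i * w ω' i ∂P

/-- Bounded vector fields on `Ω`. -/
def IsBddV (d : ℕ) (v : EnvSp d → Fin d → ℝ) : Prop := ∃ M, ∀ ω i, |v ω i| ≤ M

/-- The space `𝒱 = (ℝ^d)^{ℤ^d}` of vector fields on `ℤ^d`. -/
abbrev VS (d : ℕ) := Vert d → Fin d → ℝ

/-- The empirical measures `μ_r^{ω,v}` built from the minimizers `h_r` of the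
finite-volume Dirichlet energies. -/
def muR (d : ℕ) (ω : EnvSp d) (hr : ℕ → Vert d → ℝ) (r : ℕ) :
    Measure (EnvSp d × VS d) :=
  (((box d ((r : ℝ) + Real.sqrt r)).card : ℝ≥0∞) *
      ((box d (Real.sqrt r)).card : ℝ≥0∞))⁻¹ •
    ∑ z ∈ box d (Real.sqrt r), ∑ x ∈ box d ((r : ℝ) + Real.sqrt r),
      Measure.dirac (shift d (x + z) ω, fun y => dgradE d (hr r) (x + z + y))

/-- The localized conductances `c_ω^R`. -/
def cR (d : ℕ) (ω : EnvSp d) (R : ℝ) (e : EdgeIx d) : ℝ :=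
  if e ∈ edgesIn d (box d (2 * R)) then ω.1 e else 1

/-- The localized measure `π_ω^R`. -/
def piRloc (d : ℕ) (ω : EnvSp d) (R : ℝ) (x : Vert d) : ℝ :=
  if x ∈ box d (2 * R) then piOf d ω x
  else if x ∈ box d (4 * R) then 1 + piOf d ω x else 1

/-- The localized Dirichlet form `D_ω^R(f,f)` (each unordered edge counted once). -/
def DR (d : ℕ) (ω : EnvSp d) (R : ℝ) (f : Vert d → ℝ) : ℝ≥0∞ :=
  ∑' e : EdgeIx d, ENNReal.ofReal (cR d ω R e * (f (e.1 + unitv d e.2) - f e.1) ^ 2)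

/-- The norm `‖f‖_{ℓ^s(μ)}`. -/
def lpN (d : ℕ) (μw : Vert d → ℝ) (s : ℝ) (f : Vert d → ℝ) : ℝ≥0∞ :=
  (∑' x : Vert d, ENNReal.ofReal (|f x| ^ s * μw x)) ^ (1 / s)

/-- The exponent `ε = 2(2/d − 1/p − 1/q)((d−2)/d + 1/q)⁻¹`. -/
def epsPQ (d : ℕ) (p q : ℝ) : ℝ :=
  2 * (2 / (d : ℝ) - 1 / p - 1 / q) / (((d : ℝ) - 2) / (d : ℝ) + 1 / q)

/-- Jump rates of the localized constant-speed chain `Y^R`: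
rate `c_ω^R(x,y)/π_ω^R(x)` from `x` to `y`. -/
def rateR (d : ℕ) (ω : EnvSp d) (R : ℝ) (x y : Vert d) : ℝ :=
  (∑ i, ((if y = x + unitv d i then cR d ω R (x, i) else 0) +
         (if x = y + unitv d i then cR d ω R (y, i) else 0))) / piRloc d ω R x

/-- The generator matrix of `Y^R`. -/
def qmatR (d : ℕ) (ω : EnvSp d) (R : ℝ) (x y : Vert d) : ℝ :=
  if x = y then -(∑ z ∈ nbrs d x, rateR d ω R x z) else rateR d ω R x y

/-- Iterates of the generator matrix of `Y^R`. -/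
def qiter (d : ℕ) (ω : EnvSp d) (R : ℝ) : ℕ → Vert d → Vert d → ℝ
  | 0, x, y => if x = y then 1 else 0
  | n+1, x, y => ∑ z ∈ insert x (nbrs d x), qmatR d ω R x z * qiter d ω R n z y

/-- The heat kernel `P_ω^x(Y_t^R = y) = (e^{tQ})(x,y)` of the localized chain `Y^R`. -/
def hkR (d : ℕ) (ω : EnvSp d) (R : ℝ) (t : ℝ) (x y : Vert d) : ℝ :=
  ∑' k : ℕ, t ^ k / (Nat.factorial k : ℝ) * qiter d ω R k x y

lemma shift_shift (d : ℕ) (x y : Vert d) (ω : EnvSp d) :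
    shift d y (shift d x ω) = shift d (x + y) ω := by
  apply Subtype.ext
  funext e
  simp only [shift]
  rw [add_assoc, add_comm y x]

lemma continuous_shift (d : ℕ) (x : Vert d) : Continuous (shift d x) :=
  Continuous.subtype_mk
    (continuous_pi fun e => (continuous_apply (e.1 + x, e.2)).comp continuous_subtype_val) _

lemma continuous_conductance (d : ℕ) (e : EdgeIx d) : Continuous fun ω : EnvSp d => ω.1 e :=
  (continuous_apply e).comp continuous_subtype_val

lemma cnd_zero_unitv (d : ℕ) (ω : EnvSp d) (i : Fin d) :
    cnd d ω 0 (unitv d i) = ω.1 (0, i) := by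
  have h₁ (j : Fin d) : unitv d i = 0 + unitv d j ↔ j = i := by
    constructor
    · intro h
      by_contra hne
      have := congrFun h i
      simp [unitv, Ne.symm hne] at this
    · rintro rfl
      simp
  have h₂ (j : Fin d) : ¬ (0 : Vert d) = unitv d i + unitv d j := by
    intro h
    have := congrFun h i
    simp only [unitv, Pi.zero_apply, Pi.add_apply, if_true] at this
    split_ifs at this <;> omega
  simp only [cnd, h₁, h₂, if_false, add_zero, Finset.sum_ite_eq', Finset.mem_univ,
    if_true]

lemma mem_box_natCast {d n : ℕ} {x : Vert d} :
    x ∈ box d (n : ℝ) ↔ ∀ i, -(n : ℤ) ≤ x i ∧ x i ≤ n := by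
  simp [box, ← Int.cast_natCast (R := ℝ), ← Int.cast_neg, -Int.cast_natCast]

lemma card_box_natCast (d n : ℕ) : (box d (n : ℝ)).card = (2 * n + 1) ^ d := by
  have h : (Finset.Icc ⌈-(n : ℝ)⌉ ⌊(n : ℝ)⌋).card = 2 * n + 1 := by
    simp only [Int.ceil_neg, Int.floor_natCast, Int.card_Icc]
    omega
  rw [box, Fintype.card_piFinset_const, h]

lemma card_box_pos (d n : ℕ) : (0 : ℝ) < (box d (n : ℝ)).card := by
  rw [card_box_natCast]
  positivity

lemma pow_le_card_box (d n : ℕ) : (n : ℝ) ^ d ≤ (box d (n : ℝ)).card := by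
  rw [card_box_natCast]
  push_cast
  gcongr
  linarith

lemma mk_mem_edgesIn {d : ℕ} {Λ : Finset (Vert d)} {x : Vert d} (hx : x ∈ Λ) (i : Fin d) :
    (x, i) ∈ edgesIn d Λ := by
  simp only [edgesIn, Finset.mem_biUnion, Finset.mem_union, Finset.mem_image]
  exact ⟨x, hx, Or.inl ⟨i, Finset.mem_univ _, rfl⟩⟩

lemma fst_mem_or_add_mem_of_mem_edgesIn {d : ℕ} {Λ : Finset (Vert d)} {e : EdgeIx d}
    (he : e ∈ edgesIn d Λ) : e.1 ∈ Λ ∨ e.1 + unitv d e.2 ∈ Λ := by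
  simp only [edgesIn, Finset.mem_biUnion, Finset.mem_union, Finset.mem_image] at he
  obtain ⟨x, hx, ⟨i, -, rfl⟩ | ⟨i, -, rfl⟩⟩ := he
  · exact Or.inl hx
  · exact Or.inr (by simpa using hx)

/-- The edges of `edgesIn d Λ` with exactly one endpoint in `Λ`. -/
def boundaryEdges (d : ℕ) (Λ : Finset (Vert d)) : Finset (EdgeIx d) :=
  (edgesIn d Λ).filter fun e => ¬ (e.1 ∈ Λ ∧ e.1 + unitv d e.2 ∈ Λ)

lemma add_unitv_mem_box {d n : ℕ} {x : Vert d} (hx : x ∈ box d (n : ℝ)) (i : Fin d) :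
    x + unitv d i ∈ box d ((n + 1 : ℕ) : ℝ) := by
  rw [mem_box_natCast] at hx ⊢
  intro j
  have := hx j
  simp only [Pi.add_apply, unitv]
  split_ifs <;> push_cast <;> omega

lemma sub_unitv_mem_box {d n : ℕ} {x : Vert d} (hx : x ∈ box d (n : ℝ)) (i : Fin d) :
    x - unitv d i ∈ box d ((n + 1 : ℕ) : ℝ) := by
  rw [mem_box_natCast] at hx ⊢
  intro j
  have := hx j
  simp only [Pi.sub_apply, unitv]
  split_ifs <;> push_cast <;> omega

lemma card_boundaryEdges_box_le (d n : ℕ) :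
    (boundaryEdges d (box d ((n + 1 : ℕ) : ℝ))).card ≤
      2 * d * ((box d ((n + 1 : ℕ) : ℝ)).card - (box d (n : ℝ)).card) := by
  set S := box d ((n + 1 : ℕ) : ℝ) \ box d (n : ℝ) with hS
  have hsub : box d (n : ℝ) ⊆ box d ((n + 1 : ℕ) : ℝ) := by
    intro x hx
    rw [mem_box_natCast] at hx ⊢
    intro j
    have := hx j
    push_cast
    omega
  have hcover : boundaryEdges d (box d ((n + 1 : ℕ) : ℝ)) ⊆
      (S ×ˢ Finset.univ) ∪
        (S ×ˢ Finset.univ).image (fun e : EdgeIx d => (e.1 - unitv d e.2, e.2)) := by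
    rintro ⟨x, i⟩ he
    rw [boundaryEdges, Finset.mem_filter] at he
    obtain ⟨he, hb⟩ := he
    simp only [Finset.mem_union, Finset.mem_product, Finset.mem_univ, and_true, Finset.mem_image,
      hS, Finset.mem_sdiff]
    rcases fst_mem_or_add_mem_of_mem_edgesIn he with h | h
    · exact Or.inl ⟨h, fun h' => hb ⟨h, add_unitv_mem_box h' i⟩⟩
    · refine Or.inr ⟨(x + unitv d i, i), ⟨h, fun h' => hb ⟨?_, h⟩⟩, by simp⟩
      simpa using sub_unitv_mem_box h' i
  calc _ ≤ _ := Finset.card_le_card hcover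
    _ ≤ (S ×ˢ (Finset.univ : Finset (Fin d))).card + (S ×ˢ (Finset.univ : Finset (Fin d))).card :=
      (Finset.card_union_le _ _).trans (Nat.add_le_add_left Finset.card_image_le _)
    _ = _ := by
      rw [Finset.card_product, Finset.card_univ, Fintype.card_fin, hS,
        Finset.card_sdiff_of_subset hsub]
      ring

lemma tendsto_card_boundaryEdges_div (d : ℕ) :
    Tendsto (fun n : ℕ => ((boundaryEdges d (box d (n : ℝ))).card : ℝ) / (box d (n : ℝ)).card)
      atTop (𝓝 0) := by
  rw [← tendsto_add_atTop_iff_nat 1]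
  have hratio : Tendsto (fun n : ℕ => (2 * (n : ℝ) + 1) / (2 * n + 3)) atTop (𝓝 1) := by
    have h : Tendsto (fun n : ℕ => 1 - 2 / (2 * (n : ℝ) + 3)) atTop (𝓝 (1 - 0)) := by
      refine tendsto_const_nhds.sub (tendsto_const_nhds.div_atTop ?_)
      exact tendsto_atTop_add_const_right _ _
        (tendsto_natCast_atTop_atTop.const_mul_atTop two_pos)
    rw [sub_zero] at h
    refine h.congr fun n => ?_
    field_simp
    ring
  have hlim : Tendsto (fun n : ℕ => 2 * (d : ℝ) * (1 - ((2 * (n : ℝ) + 1) / (2 * n + 3)) ^ d))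
      atTop (𝓝 0) := by
    simpa using (((hratio.pow d).const_sub 1).const_mul (2 * (d : ℝ)))
  refine squeeze_zero (fun n => by positivity) (fun n => ?_) hlim
  have hle : (box d (n : ℝ)).card ≤ (box d ((n + 1 : ℕ) : ℝ)).card := by
    rw [card_box_natCast, card_box_natCast]
    gcongr
    omega
  have hcard : ((boundaryEdges d (box d ((n + 1 : ℕ) : ℝ))).card : ℝ) ≤
      2 * d * ((box d ((n + 1 : ℕ) : ℝ)).card - (box d (n : ℝ)).card) := by
    have := card_boundaryEdges_box_le d n
    rw [← Nat.cast_le (α := ℝ), Nat.cast_mul, Nat.cast_sub hle] at this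
    exact_mod_cast this
  rw [div_le_iff₀ (card_box_pos d (n + 1))]
  refine hcard.trans (le_of_eq ?_)
  rw [card_box_natCast, card_box_natCast, div_pow]
  have h3 : (2 * (n : ℝ) + 3) ^ d ≠ 0 := by positivity
  push_cast
  rw [show 2 * ((n : ℝ) + 1) + 1 = 2 * n + 3 by ring]
  field_simp

/-- Truncation at level `K`, with the error controlled by the `p`-th power. -/
lemma le_min_add_rpow {p c K : ℝ} (hp : 1 < p) (hc : 0 < c) (hK : 0 < K) :
    c ≤ min c K + K ^ (1 - p) * c ^ p := by
  rcases le_total c K with h | h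
  · rw [min_eq_left h]
    have := mul_pos (Real.rpow_pos_of_pos hK (1 - p)) (Real.rpow_pos_of_pos hc p)
    linarith
  · have h₁ : c = c ^ (1 - p) * c ^ p := by
      rw [← Real.rpow_add hc]
      simp
    have h₂ : c ^ (1 - p) * c ^ p ≤ K ^ (1 - p) * c ^ p :=
      mul_le_mul_of_nonneg_right
        (Real.rpow_le_rpow_of_nonpos hK h (by linarith)) (Real.rpow_pos_of_pos hc p).le
    have := le_min hc.le hK.le
    linarith

/-- A moment bound over `edgesIn d Λ_n`, normalised by the volume of `Λ_n`. -/
lemma exists_sum_rpow_le (d : ℕ) (p : ℝ) (ω : EnvSp d)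
    (h : ∃ C : ℝ, ∀ n : ℕ, 1 ≤ n →
      (∑ e ∈ edgesIn d (box d (n : ℝ)), ω.1 e ^ p) / (n : ℝ) ^ d ≤ C) :
    ∃ C : ℝ, 0 ≤ C ∧ ∀ n : ℕ, 1 ≤ n →
      ∑ e ∈ edgesIn d (box d (n : ℝ)), ω.1 e ^ p ≤ C * (box d (n : ℝ)).card := by
  obtain ⟨C, hC⟩ := h
  refine ⟨max C 0, le_max_right _ _, fun n hn => ?_⟩
  have hn' : (0 : ℝ) < (n : ℝ) ^ d := by positivity
  calc _ ≤ C * (n : ℝ) ^ d := (div_le_iff₀ hn').1 (hC n hn)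
    _ ≤ max C 0 * (n : ℝ) ^ d := by gcongr; exact le_max_left _ _
    _ ≤ _ := mul_le_mul_of_nonneg_left (pow_le_card_box d n) (le_max_right _ _)

/-- Under the law of the environment, every conductance at the origin is integrable. -/
lemma integrable_conductance {d : ℕ} {p : ℝ} (hp : 1 < p) {ω : EnvSp d}
    {C : ℝ} (hC : ∀ n : ℕ, 1 ≤ n →
      ∑ e ∈ edgesIn d (box d (n : ℝ)), ω.1 e ^ p ≤ C * (box d (n : ℝ)).card)
    {P : Measure (EnvSp d)} (hP : IsEnvLaw d ω P) (i : Fin d) :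
    Integrable (fun ω' : EnvSp d => ω'.1 (0, i)) P := by
  have := hP.1
  have hcont (K : ℝ) : Continuous fun ω' : EnvSp d => min (ω'.1 (0, i)) K :=
    (continuous_conductance d _).min continuous_const
  have hbound (K : ℕ) (ω' : EnvSp d) : |min (ω'.1 (0, i)) K| ≤ K := by
    rw [abs_of_nonneg (le_min (ω'.2 _).le K.cast_nonneg)]
    exact min_le_right _ _
  have hint (K : ℕ) : ∫ ω', min (ω'.1 (0, i)) (K : ℝ) ∂P ≤ 1 + C := by
    refine le_of_tendsto (hP.2 _ (hcont K) ⟨K, hbound K⟩) ?_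
    filter_upwards [eventually_ge_atTop 1] with n hn
    rw [div_le_iff₀ (card_box_pos d n)]
    calc ∑ x ∈ box d (n : ℝ), min ((shift d x ω).1 (0, i)) (K : ℝ)
        ≤ ∑ x ∈ box d (n : ℝ), (1 + ω.1 (x, i) ^ p) := by
          refine Finset.sum_le_sum fun x _ => ?_
          have h := le_min_add_rpow hp (ω.2 (x, i)) one_pos
          have h1 := min_le_right (ω.1 (x, i)) 1
          have h2 : (shift d x ω).1 (0, i) = ω.1 (x, i) := by simp [shift]
          rw [Real.one_rpow, one_mul] at h
          rw [h2]
          linarith [min_le_left (ω.1 (x, i)) (K : ℝ)]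
      _ = (box d (n : ℝ)).card +
            ∑ e ∈ (box d (n : ℝ)).map ⟨fun x => (x, i), fun _ _ h => (Prod.ext_iff.1 h).1⟩,
              ω.1 e ^ p := by
          simp only [Finset.sum_add_distrib, Finset.sum_const, nsmul_eq_mul, mul_one,
            Finset.sum_map]
          rfl
      _ ≤ (box d (n : ℝ)).card + ∑ e ∈ edgesIn d (box d (n : ℝ)), ω.1 e ^ p := by
          gcongr
          · intro e _ _
            exact (Real.rpow_pos_of_pos (ω.2 e) p).le
          · intro e he
            obtain ⟨x, hx, rfl⟩ := Finset.mem_map.1 he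
            exact mk_mem_edgesIn hx i
      _ ≤ (1 + C) * (box d (n : ℝ)).card := by linarith [hC n hn]
  refine ⟨(continuous_conductance d _).aestronglyMeasurable, ?_⟩
  have hle : ∫⁻ ω', ENNReal.ofReal (ω'.1 (0, i)) ∂P ≤ ENNReal.ofReal (1 + C) := by
    have hlim := lintegral_tendsto_of_tendsto_of_monotone (μ := P)
      (f := fun (K : ℕ) (ω' : EnvSp d) => ENNReal.ofReal (min (ω'.1 (0, i)) K))
      (F := fun ω' => ENNReal.ofReal (ω'.1 (0, i)))
      (fun K => (hcont K).measurable.ennreal_ofReal.aemeasurable)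
      (Eventually.of_forall fun ω' K L hKL => ENNReal.ofReal_le_ofReal
        (min_le_min_left _ (Nat.cast_le.2 hKL)))
      (Eventually.of_forall fun ω' => tendsto_const_nhds.congr' (by
        filter_upwards [eventually_ge_atTop ⌈ω'.1 (0, i)⌉₊] with K hK
        rw [min_eq_left (Nat.ceil_le.1 hK)]))
    refine le_of_tendsto' hlim fun K => ?_
    rw [← ofReal_integral_eq_lintegral_ofReal
      (Integrable.of_bound (hcont K).aestronglyMeasurable K
        (Eventually.of_forall fun ω' => hbound K ω'))
      (Eventually.of_forall fun ω' => le_min (ω'.2 _).le K.cast_nonneg)]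
    exact ENNReal.ofReal_le_ofReal (hint K)
  rw [hasFiniteIntegral_iff_ofReal (Eventually.of_forall fun ω' => (ω'.2 _).le)]
  exact hle.trans_lt ENNReal.ofReal_lt_top

lemma einner_self_nonneg (d : ℕ) (ω : EnvSp d) (Λ : Finset (Vert d)) (u : Vert d → Fin d → ℝ) :
    0 ≤ einner d ω Λ u u :=
  Finset.sum_nonneg fun e _ => mul_nonneg (mul_self_nonneg _) (ω.2 e).le

lemma direnergy_nonneg (d : ℕ) (ω : EnvSp d) (Λ : Finset (Vert d))
    (v : EnvSp d → Fin d → ℝ) : 0 ≤ direnergy d ω Λ v := by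
  refine Real.sInf_nonneg ?_
  rintro r ⟨h, -, rfl⟩
  exact einner_self_nonneg _ _ _ _

lemma direnergy_le (d : ℕ) (ω : EnvSp d) (Λ : Finset (Vert d)) (v : EnvSp d → Fin d → ℝ)
    {h : Vert d → ℝ} (hh : ∀ x ∉ Λ, h x = 0) :
    direnergy d ω Λ v ≤ einner d ω Λ (fun x i => efield d v ω x i - dgradE d h x i)
      (fun x i => efield d v ω x i - dgradE d h x i) := by
  refine csInf_le ⟨0, ?_⟩ ⟨h, hh, rfl⟩
  rintro r ⟨h, -, rfl⟩
  exact einner_self_nonneg _ _ _ _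

lemma cinnerP_self_nonneg (d : ℕ) (P : Measure (EnvSp d)) (u : EnvSp d → Fin d → ℝ) :
    0 ≤ cinnerP d P u u := by
  refine Finset.sum_nonneg fun i _ => integral_nonneg fun ω' => ?_
  simp only [cnd_zero_unitv, Pi.zero_apply, mul_assoc]
  exact mul_nonneg (ω'.2 _).le (mul_self_nonneg _)

/-- The finite-volume energy is bounded by the truncated energy of `v - ∇h`, with a boundary
term and a truncation error. -/
lemma direnergy_le_truncated {d : ℕ} {v : EnvSp d → Fin d → ℝ} {h : EnvSp d → ℝ} {M H : ℝ}
    (hM : ∀ ω i, |v ω i| ≤ M) (hH : ∀ ω, |h ω| ≤ H) {p K : ℝ} (hp : 1 < p) (hK : 0 < K)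
    (ω : EnvSp d) (Λ : Finset (Vert d)) :
    direnergy d ω Λ v ≤
      (∑ i, ∑ x ∈ Λ, min ((shift d x ω).1 (0, i)) K *
          (v (shift d x ω) i - gradOmega d h (shift d x ω) i) ^ 2) +
        (M + 2 * H) ^ 2 * K * (boundaryEdges d Λ).card +
        (M + 2 * H) ^ 2 * K ^ (1 - p) * ∑ e ∈ edgesIn d Λ, ω.1 e ^ p := by
  classical
  have hH0 : 0 ≤ H := (abs_nonneg _).trans (hH ω)
  set g : Vert d → ℝ := fun x => if x ∈ Λ then h (shift d x ω) else 0 with hg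
  have hgH (x : Vert d) : |g x| ≤ H := by
    simp only [hg]
    split_ifs
    · exact hH _
    · simpa using hH0
  set u : Vert d → Fin d → ℝ := fun x i => efield d v ω x i - dgradE d g x i with hu
  have huB (x : Vert d) (i : Fin d) : u x i ^ 2 ≤ (M + 2 * H) ^ 2 := by
    refine sq_le_sq' ?_ ?_ <;>
    · have h1 := abs_le.1 (hM (shift d x ω) i)
      have h2 := abs_le.1 (hgH (x + unitv d i))
      have h3 := abs_le.1 (hgH x)
      simp only [hu, efield, dgradE]
      linarith [h1.1, h1.2, h2.1, h2.2, h3.1, h3.2]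
  set F : EdgeIx d → ℝ := fun e => min (ω.1 e) K *
    (v (shift d e.1 ω) e.2 - gradOmega d h (shift d e.1 ω) e.2) ^ 2 with hF
  have hF0 (e : EdgeIx d) : 0 ≤ F e := mul_nonneg (le_min (ω.2 e).le hK.le) (sq_nonneg _)
  have hedge : ∀ e ∈ edgesIn d Λ, u e.1 e.2 * u e.1 e.2 * ω.1 e ≤
      (if e.1 ∈ Λ then F e else 0) +
        (if ¬ (e.1 ∈ Λ ∧ e.1 + unitv d e.2 ∈ Λ) then (M + 2 * H) ^ 2 * K else 0) +
        (M + 2 * H) ^ 2 * K ^ (1 - p) * ω.1 e ^ p := by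
    intro e _
    have htr := le_min_add_rpow hp (ω.2 e) hK
    have hpow : 0 ≤ K ^ (1 - p) * ω.1 e ^ p :=
      (mul_pos (Real.rpow_pos_of_pos hK _) (Real.rpow_pos_of_pos (ω.2 e) p)).le
    have h1 : u e.1 e.2 * u e.1 e.2 * ω.1 e ≤
        min (ω.1 e) K * u e.1 e.2 ^ 2 + (M + 2 * H) ^ 2 * K ^ (1 - p) * ω.1 e ^ p := by
      have := mul_le_mul_of_nonneg_left htr (sq_nonneg (u e.1 e.2))
      have := mul_le_mul_of_nonneg_right (huB e.1 e.2) hpow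
      nlinarith
    refine h1.trans (add_le_add_left ?_ _)
    by_cases hb : e.1 ∈ Λ ∧ e.1 + unitv d e.2 ∈ Λ
    · rw [if_pos hb.1, if_neg (not_not.2 hb), add_zero]
      simp only [hF, hu, hg, efield, dgradE, gradOmega, shift_shift, if_pos hb.1, if_pos hb.2]
      exact le_rfl
    · rw [if_pos hb]
      have h2 : min (ω.1 e) K * u e.1 e.2 ^ 2 ≤ (M + 2 * H) ^ 2 * K := by
        rw [mul_comm]
        exact mul_le_mul (huB _ _) (min_le_right _ _) (le_min (ω.2 e).le hK.le) (sq_nonneg _)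
      have h3 : 0 ≤ if e.1 ∈ Λ then F e else 0 := by
        split_ifs
        · exact hF0 e
        · exact le_rfl
      linarith
  refine (direnergy_le d ω Λ v (h := g) fun x hx => if_neg hx).trans ?_
  refine (Finset.sum_le_sum hedge).trans ?_
  rw [Finset.sum_add_distrib, Finset.sum_add_distrib, ← Finset.mul_sum]
  refine add_le_add_left (add_le_add ?_ (le_of_eq ?_)) _
  · rw [← Finset.sum_filter]
    calc _ ≤ ∑ e ∈ Λ ×ˢ Finset.univ, F e := by
          refine Finset.sum_le_sum_of_subset_of_nonneg (fun e he => ?_) fun e _ _ => hF0 e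
          simpa using (Finset.mem_filter.1 he).2
      _ = _ := by
          rw [Finset.sum_product_right]
          simp [hF, shift]
  · rw [← Finset.sum_filter, Finset.sum_const, nsmul_eq_mul, mul_comm]
    rfl

lemma limsup_direnergy_le {d : ℕ} {v : EnvSp d → Fin d → ℝ} (hv : Continuous v)
    (hvb : IsBddV d v) {p : ℝ} (hp : 1 < p) {ω : EnvSp d}
    (hmom : ∃ C : ℝ, ∀ n : ℕ, 1 ≤ n →
      (∑ e ∈ edgesIn d (box d (n : ℝ)), ω.1 e ^ p) / (n : ℝ) ^ d ≤ C)
    {P : Measure (EnvSp d)} (hP : IsEnvLaw d ω P)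
    {h : EnvSp d → ℝ} (hh : Continuous h) (hhb : IsBdd d h) :
    limsup (fun r : ℕ =>
        direnergy d ω (box d (r : ℝ)) v / ((box d (r : ℝ)).card : ℝ)) atTop ≤
      cinnerP d P (fun ω' i => v ω' i - gradOmega d h ω' i)
        (fun ω' i => v ω' i - gradOmega d h ω' i) := by
  obtain ⟨C, hC0, hC⟩ := exists_sum_rpow_le d p ω hmom
  obtain ⟨M, hM⟩ := hvb
  obtain ⟨H, hH⟩ := hhb
  have := hP.1
  set B : ℝ := (M + 2 * H) ^ 2 with hB
  set w : EnvSp d → Fin d → ℝ := fun ω' i => v ω' i - gradOmega d h ω' i with hw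
  have hwc (i : Fin d) : Continuous fun ω' => w ω' i :=
    ((continuous_apply i).comp hv).sub ((hh.comp (continuous_shift d _)).sub hh)
  have hwB (ω' : EnvSp d) (i : Fin d) : w ω' i ^ 2 ≤ B := by
    refine sq_le_sq' ?_ ?_ <;>
    · have h1 := abs_le.1 (hM ω' i)
      have h2 := abs_le.1 (hH (shift d (unitv d i) ω'))
      have h3 := abs_le.1 (hH ω')
      simp only [hw, gradOmega]
      linarith [h1.1, h1.2, h2.1, h2.2, h3.1, h3.2]
  set T := cinnerP d P w w with hT
  have htrunc (K : ℝ) (hK : 0 < K) : limsup (fun r : ℕ =>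
      direnergy d ω (box d (r : ℝ)) v / ((box d (r : ℝ)).card : ℝ)) atTop ≤
      T + B * K ^ (1 - p) * C := by
    set f : Fin d → EnvSp d → ℝ := fun i ω' => min (ω'.1 (0, i)) K * w ω' i ^ 2 with hf
    have hfc (i : Fin d) : Continuous (f i) :=
      ((continuous_conductance d _).min continuous_const).mul ((hwc i).pow 2)
    have hf0 (i : Fin d) (ω' : EnvSp d) : 0 ≤ f i ω' :=
      mul_nonneg (le_min (ω'.2 _).le hK.le) (sq_nonneg _)
    have hfb (i : Fin d) (ω' : EnvSp d) : |f i ω'| ≤ K * B := by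
      rw [abs_of_nonneg (hf0 i ω')]
      exact mul_le_mul (min_le_right _ _) (hwB ω' i) (sq_nonneg _) hK.le
    have hfT : ∑ i, ∫ ω', f i ω' ∂P ≤ T := by
      refine Finset.sum_le_sum fun i _ => integral_mono
        (Integrable.of_bound (hfc i).aestronglyMeasurable (K * B)
          (Eventually.of_forall (hfb i))) ?_ fun ω' => ?_
      · simp only [cnd_zero_unitv, mul_assoc]
        refine (integrable_conductance hp hC hP i).mul_bdd (c := B)
          ((hwc i).mul (hwc i)).aestronglyMeasurable (Eventually.of_forall fun ω' => ?_)
        rw [Real.norm_of_nonneg (mul_self_nonneg _), ← sq]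
        exact hwB ω' i
      · simp only [cnd_zero_unitv, hf, mul_assoc, ← sq]
        exact mul_le_mul_of_nonneg_right (min_le_left _ _) (sq_nonneg _)
    have hlim : Tendsto (fun n : ℕ =>
        (∑ i, (∑ x ∈ box d (n : ℝ), f i (shift d x ω)) / ((box d (n : ℝ)).card : ℝ)) +
          B * K * (((boundaryEdges d (box d (n : ℝ))).card : ℝ) / (box d (n : ℝ)).card) +
          B * K ^ (1 - p) * C) atTop
        (𝓝 ((∑ i, ∫ ω', f i ω' ∂P) + B * K * 0 + B * K ^ (1 - p) * C)) :=
      ((tendsto_finsetSum _ fun i _ => hP.2 (f i) (hfc i) ⟨_, hfb i⟩).add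
        ((tendsto_card_boundaryEdges_div d).const_mul _)).add tendsto_const_nhds
    have hle : ∀ᶠ n : ℕ in atTop, direnergy d ω (box d (n : ℝ)) v / ((box d (n : ℝ)).card : ℝ) ≤
        (∑ i, (∑ x ∈ box d (n : ℝ), f i (shift d x ω)) / ((box d (n : ℝ)).card : ℝ)) +
          B * K * (((boundaryEdges d (box d (n : ℝ))).card : ℝ) / (box d (n : ℝ)).card) +
          B * K ^ (1 - p) * C := by
      filter_upwards [eventually_ge_atTop 1] with n hn
      have hpos := card_box_pos d n
      have hBK : 0 ≤ B * K ^ (1 - p) := mul_nonneg (sq_nonneg _) (Real.rpow_pos_of_pos hK _).le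
      rw [div_le_iff₀ hpos, add_mul, add_mul, Finset.sum_mul]
      simp only [mul_assoc, div_mul_cancel₀ _ hpos.ne']
      refine (direnergy_le_truncated hM hH hp hK ω (box d (n : ℝ))).trans ?_
      simp only [← mul_assoc]
      refine add_le_add le_rfl ?_
      rw [mul_assoc _ C]
      exact mul_le_mul_of_nonneg_left (hC n hn) hBK
    calc _ ≤ _ := limsup_le_limsup hle
          (isCoboundedUnder_le_of_le (x := 0) atTop fun n =>
            div_nonneg (direnergy_nonneg _ _ _ _) (Nat.cast_nonneg _))
          hlim.isBoundedUnder_le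
      _ = _ := hlim.limsup_eq
      _ ≤ _ := by linarith
  have hK : Tendsto (fun K : ℝ => T + B * K ^ (1 - p) * C) atTop (𝓝 (T + B * 0 * C)) := by
    have := tendsto_rpow_neg_atTop (y := p - 1) (by linarith)
    rw [neg_sub] at this
    exact ((this.const_mul B).mul_const C).const_add T
  rw [mul_zero, zero_mul, add_zero] at hK
  refine ge_of_tendsto hK ?_
  filter_upwards [eventually_gt_atTop 0] with K hK0 using htrunc K hK0

/-- STATEMENT 16 (Lemma 5.6): upper bound on the limiting Dirichlet energy. -/
theorem statement16 (d : ℕ) (hd : 1 ≤ d) (v : EnvSp d → Fin d → ℝ)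
    (hv : Continuous v) (hvb : IsBddV d v) (p q : ℝ) (hp : 1 < p) (hq : 1 < q)
    (ω : EnvSp d) (hstar : InOmegaStar d ω) (hmom : InOmegaPQ d p q ω)
    (P : Measure (EnvSp d)) (hP : IsEnvLaw d ω P) :
    limsup (fun r : ℕ =>
        direnergy d ω (box d (r : ℝ)) v / ((box d (r : ℝ)).card : ℝ)) atTop ≤
      sInf {t : ℝ | ∃ h : EnvSp d → ℝ, Continuous h ∧ IsBdd d h ∧
          t = cinnerP d P (fun ω' i => v ω' i - gradOmega d h ω' i)
                (fun ω' i => v ω' i - gradOmega d h ω' i)} := by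
  refine le_csInf ⟨_, fun _ => 0, continuous_const, ⟨0, by simp⟩, rfl⟩ ?_
  rintro t ⟨h, hh, hhb, rfl⟩
  exact limsup_direnergy_le hv hvb hp hmom.1 hP hh hhb


end DetCond
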